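/- Let X be a metrizable space that is a Souslin-F set in some completely metrizable space Z containing it (i.e., X is an absolute Souslin-F set), and let Y be a metric space. Then a mapping f : X → Y is Δ⁰₂-measurable if and only if it is piecewise continuous. -/

import Mathlib

open Set Topology

/-- A set is Fσ if it is a countable union of closed sets. -/
def IsFsigma {X : Type*} [TopologicalSpace X] (s : Set X) : Prop :=
  ∃ C : ℕ → Set X, (∀ n, IsClosed (C n)) ∧ s = ⋃ n, C n

/-- A map is piecewise continuous if its domain is covered by countably many
closed sets on each of which the map is continuous. -/
def PiecewiseContinuous {X Y : Type*} [TopologicalSpace X] [TopologicalSpace Y]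
    (f : X → Y) : Prop :=
  ∃ C : ℕ → Set X, (∀ n, IsClosed (C n)) ∧ (⋃ n, C n) = Set.univ ∧
    ∀ n, ContinuousOn f (C n)

/-- A map is Δ⁰₂-measurable if preimages of open sets are both Fσ and Gδ. -/
def Delta02Measurable {X Y : Type*} [TopologicalSpace X] [TopologicalSpace Y]
    (f : X → Y) : Prop :=
  ∀ U : Set Y, IsOpen U → IsFsigma (f ⁻¹' U) ∧ IsGδ (f ⁻¹' U)

/-- A map is Σ⁰₂-measurable if preimages of open sets are Fσ. -/
def Sigma02Measurable {X Y : Type*} [TopologicalSpace X] [TopologicalSpace Y]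
    (f : X → Y) : Prop :=
  ∀ U : Set Y, IsOpen U → IsFsigma (f ⁻¹' U)

/-- X ⊆ Z is Souslin-F in Z: the result of the A-operation applied to a system
of closed subsets of Z, where `(List.range n).map α` encodes α|n. -/
def SouslinF {Z : Type*} [TopologicalSpace Z] (X : Set Z) : Prop :=
  ∃ F : List ℕ → Set Z, (∀ s, IsClosed (F s)) ∧
    X = ⋃ α : ℕ → ℕ, ⋂ n : ℕ, F ((List.range n).map α)

/-- A space is completely Baire if every closed subspace is a Baire space. -/
def CompletelyBaire (Z : Type*) [TopologicalSpace Z] : Prop :=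
  ∀ s : Set Z, IsClosed s → BaireSpace s

/-- Membership in the σ-ideal I_f: A is contained in an Fσ set F such that
the restriction f|F is piecewise continuous. -/
def MemIf {X Y : Type*} [TopologicalSpace X] [TopologicalSpace Y]
    (f : X → Y) (A : Set X) : Prop :=
  ∃ F : Set X, IsFsigma F ∧ A ⊆ F ∧ PiecewiseContinuous (F.restrict f)

/-- A^f = f⁻¹(Y \ cl(A)). -/
def Af {X Y : Type*} [TopologicalSpace Y] (f : X → Y) (A : Set Y) : Set X :=
  f ⁻¹' (closure A)ᶜ

/-- The pair (x, X′) is f-irreducible outside A: for every open neighborhood V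
of x, A^f ∩ X′ ∩ V ∉ I_f. -/
def IrredOutside {X Y : Type*} [TopologicalSpace X] [TopologicalSpace Y]
    (f : X → Y) (x : X) (X' : Set X) (A : Set Y) : Prop :=
  ∀ V : Set X, IsOpen V → x ∈ V → ¬ MemIf f (Af f A ∩ X' ∩ V)

open Filter

section Pieces

variable {X Y : Type*} [MetricSpace X] [MetricSpace Y] {f : X → Y}

/-- `A` is covered by countably many closed sets on each of which `f` is continuous. -/
def CoveredByContinuousPieces (f : X → Y) (A : Set X) : Prop :=
  ∃ C : ℕ → Set X, (∀ n, IsClosed (C n)) ∧ A ⊆ ⋃ n, C n ∧ ∀ n, ContinuousOn f (C n)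

/-- Every neighbourhood of `x` meets `A ∩ f ⁻¹' W` in a set which is not covered by countably
many closed sets on which `f` is continuous. -/
def IrreducibleWithin (f : X → Y) (x : X) (A : Set X) (W : Set Y) : Prop :=
  ∀ V : Set X, IsOpen V → x ∈ V → ¬ CoveredByContinuousPieces f (A ∩ V ∩ f ⁻¹' W)

theorem CoveredByContinuousPieces.mono {A B : Set X} (hB : CoveredByContinuousPieces f B)
    (h : A ⊆ B) : CoveredByContinuousPieces f A := by
  obtain ⟨C, h1, h2, h3⟩ := hB
  exact ⟨C, h1, h.trans h2, h3⟩

theorem CoveredByContinuousPieces.iUnion {A : ℕ → Set X}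
    (h : ∀ n, CoveredByContinuousPieces f (A n)) :
    CoveredByContinuousPieces f (⋃ n, A n) := by
  choose C h1 h2 h3 using h
  refine ⟨fun k => C k.unpair.1 k.unpair.2, fun k => h1 _ _, ?_, fun k => h3 _ _⟩
  refine iUnion_subset fun n x hx => ?_
  obtain ⟨m, hm⟩ := mem_iUnion.1 (h2 n hx)
  exact mem_iUnion.2 ⟨Nat.pair n m, by simpa using hm⟩

theorem CoveredByContinuousPieces.union {A B : Set X} (hA : CoveredByContinuousPieces f A)
    (hB : CoveredByContinuousPieces f B) : CoveredByContinuousPieces f (A ∪ B) := by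
  refine (CoveredByContinuousPieces.iUnion
    (A := fun n : ℕ => if n = 0 then A else B) fun n => ?_).mono ?_
  · split_ifs
    exacts [hA, hB]
  · rintro x (hx | hx)
    · exact mem_iUnion.2 ⟨0, by simpa using hx⟩
    · exact mem_iUnion.2 ⟨1, by simpa using hx⟩

/-- Being covered by continuous pieces is a local property, by paracompactness. -/
theorem CoveredByContinuousPieces.of_local {A : Set X}
    (h : ∀ x ∈ A, ∃ V, IsOpen V ∧ x ∈ V ∧ CoveredByContinuousPieces f (A ∩ V)) :
    CoveredByContinuousPieces f A := by
  choose! V hVo hxV C hCc hAC hCf using h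
  have hO : IsOpen (⋃ a : A, V a) := isOpen_iUnion fun a => hVo a a.2
  obtain ⟨E, hEc, -, hEO, -⟩ := hO.exists_iUnion_isClosed
  have hA : A ⊆ ⋃ m, A ∩ E m := by
    rw [← inter_iUnion, hEO]
    exact fun x hx => ⟨hx, mem_iUnion.2 ⟨⟨x, hx⟩, hxV x hx⟩⟩
  refine (CoveredByContinuousPieces.iUnion fun m => ?_).mono hA
  obtain ⟨u, -, hEu, hlf, huV⟩ := precise_refinement_set (hEc m) (fun a : A => V a)
    (fun a => hVo a a.2) (by rw [← hEO]; exact subset_iUnion E m)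
  have hlf' : ∀ n, LocallyFinite fun a : A => closure (u a) ∩ C a n := fun n =>
    hlf.closure.subset fun a => inter_subset_left
  have hcl : ∀ n (a : A), IsClosed (closure (u a) ∩ C a n) := fun n a =>
    isClosed_closure.inter (hCc a a.2 n)
  refine ⟨fun n => ⋃ a : A, closure (u a) ∩ C a n, fun n => (hlf' n).isClosed_iUnion (hcl n),
    ?_, fun n => (hlf' n).continuousOn_iUnion (hcl n)
      fun a => (hCf a a.2 n).mono inter_subset_right⟩
  rintro x ⟨hx, hxE⟩
  obtain ⟨a, ha⟩ := mem_iUnion.1 (hEu hxE)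
  obtain ⟨n, hn⟩ := mem_iUnion.1 (hAC a a.2 ⟨hx, huV a ha⟩)
  exact mem_iUnion.2 ⟨n, mem_iUnion.2 ⟨a, subset_closure ha, hn⟩⟩

theorem IrreducibleWithin.mono {x : X} {A B : Set X} {W W' : Set Y}
    (h : IrreducibleWithin f x A W) (hAB : A ⊆ B) (hW : W ⊆ W') :
    IrreducibleWithin f x B W' := fun V hV hx hc =>
  h V hV hx (hc.mono (inter_subset_inter (inter_subset_inter_left _ hAB) (preimage_mono hW)))

/-- If `A` is not covered by continuous pieces, then some point of its closure is irreducible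
outside a neighbourhood of its value. -/
theorem exists_irreducibleWithin_compl_closedBall {A : Set X}
    (hA : ¬ CoveredByContinuousPieces f A) :
    ∃ x ∈ closure A, ∃ r > 0, IrreducibleWithin f x A (Metric.closedBall (f x) r)ᶜ := by
  by_contra! hbad
  let L : Set X := {a | ∃ V, IsOpen V ∧ a ∈ V ∧ CoveredByContinuousPieces f (A ∩ V)}
  have hL : CoveredByContinuousPieces f (A ∩ L) := by
    refine .of_local fun x hx => ?_
    obtain ⟨V, hV, hxV, hc⟩ := hx.2
    exact ⟨V, hV, hxV, hc.mono (inter_subset_inter_left _ inter_subset_left)⟩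
  have hcont : ContinuousOn f (closure (A \ L)) := by
    intro x hx
    rw [ContinuousWithinAt, Metric.tendsto_nhds]
    intro ε hε
    have hloc : ∀ y ∈ closure (A \ L), ∃ V, IsOpen V ∧ y ∈ V ∧
        CoveredByContinuousPieces f (A ∩ V ∩ f ⁻¹' (Metric.closedBall (f y) (ε / 3))ᶜ) := by
      intro y hy
      have := hbad y (closure_mono sdiff_subset hy) (ε / 3) (by positivity)
      simpa only [IrreducibleWithin, not_forall, not_not, exists_prop] using this
    obtain ⟨V, hV, hxV, hc⟩ := hloc x hx
    filter_upwards [inter_mem_nhdsWithin _ (hV.mem_nhds hxV)] with y hy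
    obtain ⟨V', hV', hyV', hc'⟩ := hloc y hy.1
    obtain ⟨a, haV, haA⟩ := mem_closure_iff.1 hy.1 (V ∩ V') (hV.inter hV') ⟨hy.2, hyV'⟩
    by_contra! hd
    refine haA.2 ⟨V ∩ V', hV.inter hV', haV, (hc.union hc').mono ?_⟩
    rintro p ⟨hpA, hpV, hpV'⟩
    by_contra hp
    simp only [mem_union, mem_inter_iff, hpA, hpV, hpV', true_and, mem_preimage, mem_compl_iff,
      Metric.mem_closedBall, not_or, not_not] at hp
    have := dist_triangle_left (f y) (f x) (f p)
    linarith
  have hd : CoveredByContinuousPieces f (A \ L) :=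
    ⟨fun _ => closure (A \ L), fun _ => isClosed_closure,
      fun x hx => mem_iUnion.2 ⟨0, subset_closure hx⟩, fun _ => hcont⟩
  exact hA ((hL.union hd).mono (inter_union_sdiff A L).ge)

/-- A set which is not covered by continuous pieces and lies in the preimage of an open set has
such a subset whose closure still lies in the preimage. -/
theorem exists_subset_closure_subset_preimage {A : Set X} {W : Set Y}
    (hf : IsFsigma (f ⁻¹' W)) (hA : ¬ CoveredByContinuousPieces f (A ∩ f ⁻¹' W)) :
    ∃ B ⊆ A, closure B ⊆ f ⁻¹' W ∧ ¬ CoveredByContinuousPieces f B := by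
  obtain ⟨C, hC, hCW⟩ := hf
  rw [hCW, inter_iUnion] at hA
  by_contra! h
  refine hA (.iUnion fun n => h _ inter_subset_left ?_)
  rw [hCW]
  exact (closure_minimal inter_subset_right (hC n)).trans (subset_iUnion C n)

/-- The irreducible point can be chosen so that finitely many given irreducible pairs stay
irreducible. -/
theorem exists_irreducibleWithin_preserving {ι : Type*}
    (hf : ∀ U : Set Y, IsOpen U → IsFsigma (f ⁻¹' U)) {x : ι → X} {B : ι → Set X} {W : Set Y}
    (I : Finset ι) (hI : ∀ i ∈ I, IrreducibleWithin f (x i) (B i) W) {A : Set X}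
    (hA : ¬ CoveredByContinuousPieces f A) :
    ∃ y ∈ closure A, ∃ r > 0, IrreducibleWithin f y A (Metric.closedBall (f y) r)ᶜ ∧
      ∀ i ∈ I, IrreducibleWithin f (x i) (B i) (W ∩ (Metric.closedBall (f y) r)ᶜ) := by
  classical
  induction I using Finset.strongInduction generalizing A with
  | H I ih =>
    obtain ⟨y₀, hy₀, r₀, hr₀, hirr⟩ := exists_irreducibleWithin_compl_closedBall hA
    by_cases hall : ∀ i ∈ I,
        IrreducibleWithin f (x i) (B i) (W ∩ (Metric.closedBall (f y₀) r₀)ᶜ)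
    · exact ⟨y₀, hy₀, r₀, hr₀, hirr, hall⟩
    push Not at hall
    obtain ⟨i₀, hi₀, hfail⟩ := hall
    have hA' := hirr univ isOpen_univ (mem_univ _)
    rw [inter_univ] at hA'
    obtain ⟨A', hAA', hcl, hA'⟩ := exists_subset_closure_subset_preimage
      (hf _ Metric.isClosed_closedBall.isOpen_compl) hA'
    obtain ⟨y, hy, r, hr, hyirr, hyI⟩ := ih (I.erase i₀) (Finset.erase_ssubset hi₀)
      (fun i hi => hI i (Finset.mem_of_mem_erase hi)) hA'
    have hdist : r₀ < dist (f y) (f y₀) := by simpa using hcl hy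
    set r' := min r ((dist (f y) (f y₀) - r₀) / 2)
    have hballs : (Metric.closedBall (f y) r)ᶜ ⊆ (Metric.closedBall (f y) r')ᶜ :=
      compl_subset_compl.2 (Metric.closedBall_subset_closedBall (min_le_left _ _))
    refine ⟨y, closure_mono hAA' hy, r', lt_min hr (by linarith), hyirr.mono hAA' hballs,
      fun i hi => ?_⟩
    by_cases hii : i = i₀
    · subst hii
      simp only [IrreducibleWithin, not_forall, not_not, exists_prop] at hfail
      obtain ⟨V, hV, hxV, hc⟩ := hfail
      intro V' hV' hxV' hc'
      refine hI i hi (V ∩ V') (hV.inter hV') ⟨hxV, hxV'⟩ ((hc.union hc').mono ?_)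
      rintro p ⟨⟨hpB, hpV, hpV'⟩, hpW⟩
      by_contra hp
      have hpW : f p ∈ W := hpW
      simp only [mem_union, mem_inter_iff, hpB, hpV, hpV', hpW, true_and, mem_preimage,
        mem_compl_iff, Metric.mem_closedBall, not_or, not_not] at hp
      have h1 := dist_triangle_left (f y) (f y₀) (f p)
      have h2 := min_le_right r ((dist (f y) (f y₀) - r₀) / 2)
      linarith [hp.1, hp.2]
    · exact (hyI i (Finset.mem_erase.2 ⟨hii, hi⟩)).mono subset_rfl
        (inter_subset_inter_right _ hballs)

end Pieces

/-- A sequence can be built one term at a time, each choice depending on the previous terms. -/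
theorem exists_seq_of_forall_exists_update {α : Type*} (P : ℕ → (ℕ → α) → Prop)
    (hcongr : ∀ n g h, (∀ i < n, g i = h i) → P n g → P n h) (h0 : ∃ g, P 0 g)
    (hstep : ∀ n g, P n g → ∃ a, P (n + 1) (Function.update g n a)) : ∃ g, ∀ n, P n g := by
  obtain ⟨g₀, hg₀⟩ := h0
  have : Nonempty α := ⟨g₀ 0⟩
  choose! a ha using hstep
  let G : ℕ → ℕ → α := fun n => Nat.rec g₀ (fun n g => Function.update g n (a n g)) n
  have hG : ∀ n, P n (G n) := fun n => by
    induction n with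
    | zero => exact hg₀
    | succ n ih => exact ha n _ ih
  have hstable : ∀ i n, i < n → G n i = G (i + 1) i := by
    intro i n hn
    induction n, hn using Nat.le_induction with
    | base => rfl
    | succ n hn ih =>
      rw [← ih]
      exact Function.update_of_ne (Nat.ne_of_lt hn) _ _
  exact ⟨fun i => G (i + 1) i, fun n => hcongr n _ _ (fun i hi => hstable i n hi) (hG n)⟩

section Scheme

variable {X Y : Type*} [MetricSpace Y]

/-- A node of the tree of irreducible points: the point, the set it is irreducible in, the radius
of the excluded ball around its value, and the index of the Souslin piece it lives in. -/
structure SchemeNode (X : Type*) where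
  point : X
  piece : Set X
  radius : ℝ
  code : List ℕ

/-- The set of values lying strictly outside the balls attached to the first `n` nodes. -/
def outerRegion (f : X → Y) (g : ℕ → SchemeNode X) (n : ℕ) : Set Y :=
  {y | ∀ j < n, (g j).radius < dist y (f (g j).point)}

theorem isOpen_outerRegion (f : X → Y) (g : ℕ → SchemeNode X) (n : ℕ) :
    IsOpen (outerRegion f g n) := by
  have : outerRegion f g n =
      ⋂ j ∈ Finset.range n, {y | (g j).radius < dist y (f (g j).point)} := by
    ext y
    simp [outerRegion]
  rw [this]
  exact isOpen_biInter_finset fun j _ =>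
    isOpen_lt continuous_const (continuous_id.dist continuous_const)

theorem outerRegion_congr (f : X → Y) {g h : ℕ → SchemeNode X} {n : ℕ}
    (hgh : ∀ i < n, g i = h i) : outerRegion f g n = outerRegion f h n := by
  ext y
  refine forall₂_congr fun j hj => ?_
  rw [hgh j hj]

variable [MetricSpace X]

/-- The first `n` nodes of `g` form a tree of irreducible points, node `i + 1` being a child of
node `(Nat.unpair i).1` within distance `1 / (i + 1)`. -/
structure IsSchemeUpTo (f : X → Y) (S : List ℕ → Set X) (n : ℕ) (g : ℕ → SchemeNode X) :
    Prop where
  point_mem : ∀ i < n, (g i).point ∈ closure (g i).piece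
  radius_pos : ∀ i < n, 0 < (g i).radius
  irreducible : ∀ i < n, IrreducibleWithin f (g i).point (g i).piece (outerRegion f g n)
  piece_subset : ∀ i < n, (g i).piece ⊆ S (g i).code
  closure_subset : ∀ i < n, closure (g i).piece ⊆ f ⁻¹' outerRegion f g i
  code_root : 0 < n → (g 0).code = []
  child : ∀ i, i + 1 < n → (g (i + 1)).piece ⊆ (g i.unpair.1).piece ∧
    (g (i + 1)).piece ⊆ Metric.closedBall (g i.unpair.1).point (1 / ((i : ℝ) + 1)) ∧
    ∃ a, (g (i + 1)).code = (g i.unpair.1).code ++ [a]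

theorem IsSchemeUpTo.congr {f : X → Y} {S : List ℕ → Set X} {n : ℕ} {g h : ℕ → SchemeNode X}
    (hg : IsSchemeUpTo f S n g) (hgh : ∀ i < n, g i = h i) : IsSchemeUpTo f S n h where
  point_mem i hi := hgh i hi ▸ hg.point_mem i hi
  radius_pos i hi := hgh i hi ▸ hg.radius_pos i hi
  irreducible i hi := hgh i hi ▸ outerRegion_congr f hgh ▸ hg.irreducible i hi
  piece_subset i hi := hgh i hi ▸ hg.piece_subset i hi
  closure_subset i hi := by
    rw [← hgh i hi, ← outerRegion_congr f fun j hj => hgh j (hj.trans hi)]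
    exact hg.closure_subset i hi
  code_root hn := hgh 0 hn ▸ hg.code_root hn
  child i hi := by
    rw [← hgh _ hi, ← hgh _ ((Nat.unpair_left_le i).trans_lt (Nat.lt_of_succ_lt hi))]
    exact hg.child i hi

theorem IsSchemeUpTo.exists_update {f : X → Y} {S : List ℕ → Set X} {n : ℕ}
    {g : ℕ → SchemeNode X} (hf : ∀ U : Set Y, IsOpen U → IsFsigma (f ⁻¹' U))
    (hS0 : S [] = univ) (hS : ∀ s, S s ⊆ ⋃ a, S (s ++ [a]))
    (huniv : ¬ CoveredByContinuousPieces f univ) (hg : IsSchemeUpTo f S n g) :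
    ∃ a, IsSchemeUpTo f S (n + 1) (Function.update g n a) := by
  obtain ⟨A, s, hA, hAS, hAcl, hroot, hchild⟩ : ∃ (A : Set X) (s : List ℕ),
      ¬ CoveredByContinuousPieces f A ∧ A ⊆ S s ∧ closure A ⊆ f ⁻¹' outerRegion f g n ∧
      (n = 0 → s = []) ∧ ∀ i, i + 1 = n → A ⊆ (g i.unpair.1).piece ∧
        A ⊆ Metric.closedBall (g i.unpair.1).point (1 / ((i : ℝ) + 1)) ∧
        ∃ a, s = (g i.unpair.1).code ++ [a] := by
    cases n with
    | zero =>
      exact ⟨univ, [], huniv, hS0.ge, fun x _ j hj => absurd hj (Nat.not_lt_zero j),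
        fun _ => rfl, by simp⟩
    | succ m =>
      have hp : m.unpair.1 < m + 1 := Nat.lt_succ_of_le (Nat.unpair_left_le m)
      obtain ⟨B, hB, hBcl, hBc⟩ := exists_subset_closure_subset_preimage
        (hf _ (isOpen_outerRegion f g (m + 1)))
        (hg.irreducible _ hp (Metric.ball (g m.unpair.1).point (1 / ((m : ℝ) + 1)))
          Metric.isOpen_ball (Metric.mem_ball_self Nat.one_div_pos_of_nat))
      obtain ⟨a, ha⟩ : ∃ a, ¬ CoveredByContinuousPieces f
          (B ∩ S ((g m.unpair.1).code ++ [a])) := by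
        by_contra! h
        refine hBc ((CoveredByContinuousPieces.iUnion h).mono fun x hx => ?_)
        rw [← inter_iUnion]
        exact ⟨hx, hS _ (hg.piece_subset _ hp (hB hx).1)⟩
      refine ⟨_, _, ha, inter_subset_right, (closure_mono inter_subset_left).trans hBcl,
        by simp, fun i hi => ?_⟩
      obtain rfl : i = m := by omega
      exact ⟨fun x hx => (hB hx.1).1, fun x hx => Metric.ball_subset_closedBall (hB hx.1).2,
        a, rfl⟩
  obtain ⟨y, hy, r, hr, hyA, hyI⟩ := exists_irreducibleWithin_preserving hf
    (x := fun i => (g i).point) (B := fun i => (g i).piece) (Finset.range n)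
    (fun i hi => hg.irreducible i (Finset.mem_range.1 hi)) hA
  refine ⟨⟨y, A, r, s⟩, ?_⟩
  set h := Function.update g n ⟨y, A, r, s⟩
  have hn : h n = ⟨y, A, r, s⟩ := Function.update_self _ _ _
  have hlt : ∀ i < n, h i = g i := fun i hi => Function.update_of_ne hi.ne _ _
  have hreg : ∀ i ≤ n, outerRegion f h i = outerRegion f g i := fun i hi =>
    outerRegion_congr f fun j hj => hlt j (hj.trans_le hi)
  have hregn : outerRegion f g n ∩ (Metric.closedBall (f y) r)ᶜ ⊆ outerRegion f h (n + 1) := by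
    rintro z ⟨hz, hzr⟩ j hj
    rcases Nat.lt_succ_iff_lt_or_eq.1 hj with hj | rfl
    · rw [hlt j hj]
      exact hz j hj
    · rw [hn]
      simpa using hzr
  have hcases : ∀ {Q : ℕ → Prop}, (∀ i < n, Q i) → Q n → ∀ i < n + 1, Q i := by
    intro Q h1 h2 i hi
    rcases Nat.lt_succ_iff_lt_or_eq.1 hi with hi | rfl
    exacts [h1 i hi, h2]
  constructor
  · refine hcases (fun i hi => ?_) (by rwa [hn])
    rw [hlt i hi]
    exact hg.point_mem i hi
  · refine hcases (fun i hi => ?_) (by rwa [hn])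
    rw [hlt i hi]
    exact hg.radius_pos i hi
  · refine hcases (fun i hi => ?_) ?_
    · rw [hlt i hi]
      exact (hyI i (Finset.mem_range.2 hi)).mono subset_rfl hregn
    · rw [hn]
      intro V hV hyV hc
      refine hyA V hV hyV (hc.mono fun p hp => ⟨hp.1, hregn ⟨?_, hp.2⟩⟩)
      exact hAcl (subset_closure hp.1.1)
  · refine hcases (fun i hi => ?_) (by rwa [hn])
    rw [hlt i hi]
    exact hg.piece_subset i hi
  · refine hcases (fun i hi => ?_) (by rwa [hn, hreg n le_rfl])
    rw [hlt i hi, hreg i hi.le]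
    exact hg.closure_subset i hi
  · intro _
    rcases Nat.eq_zero_or_pos n with h0 | h0
    · rw [← h0, hn]
      exact hroot h0
    · rw [hlt 0 h0]
      exact hg.code_root h0
  · intro i hi
    rw [hlt i.unpair.1 ((Nat.unpair_left_le i).trans_lt (Nat.lt_of_succ_lt_succ hi))]
    rcases Nat.lt_succ_iff_lt_or_eq.1 hi with hi | hi
    · rw [hlt _ hi]
      exact hg.child i hi
    · rw [hi, hn]
      exact hchild i hi

/-- If `X` carries a Souslin scheme `S` along whose branches Cauchy sequences converge, then every
Δ⁰₂-measurable map on `X` has its domain covered by continuous pieces. -/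
theorem Delta02Measurable.coveredByContinuousPieces {f : X → Y} (hf : Delta02Measurable f)
    {S : List ℕ → Set X} (hS0 : S [] = univ) (hS : ∀ s, S s ⊆ ⋃ a, S (s ++ [a]))
    (hconv : ∀ (α : ℕ → ℕ) (u : ℕ → X), CauchySeq u →
      (∀ k j, k ≤ j → u j ∈ closure (S ((List.range k).map α))) →
      ∃ x, Tendsto u atTop (𝓝 x)) :
    CoveredByContinuousPieces f univ := by
  by_contra huniv
  obtain ⟨x₀, -⟩ : ∃ x : X, x ∈ closure univ :=
    (exists_irreducibleWithin_compl_closedBall huniv).imp fun _ h => h.1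
  obtain ⟨g, hg⟩ := exists_seq_of_forall_exists_update (IsSchemeUpTo f S)
    (fun n g h hgh hg => hg.congr hgh)
    ⟨fun _ => ⟨x₀, ∅, 0, []⟩, by constructor <;> simp⟩
    (fun n g hg => hg.exists_update (fun U hU => (hf U hU).1) hS0 hS huniv)
  have hmem i : (g i).point ∈ closure (g i).piece := (hg (i + 1)).point_mem i i.lt_succ_self
  have hchild i := (hg (i + 2)).child i (Nat.lt_succ_self _)
  let U : Set Y := ⋃ j, Metric.ball (f (g j).point) (g j).radius
  have hU : IsOpen U := isOpen_iUnion fun _ => Metric.isOpen_ball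
  obtain ⟨O, hO, hUO⟩ := isGδ_iff_eq_iInter_nat.1 (hf U hU).2
  have hpO : ∀ k i, (g i).point ∈ O k := by
    intro k i
    refine mem_iInter.1 (hUO.le (mem_iUnion.2 ⟨i, ?_⟩)) k
    exact Metric.mem_ball_self ((hg (i + 1)).radius_pos i i.lt_succ_self)
  have hnext : ∀ k i, ∃ m, i ≤ m ∧ k ≤ m ∧ m.unpair.1 = i ∧
      Metric.closedBall (g i).point (1 / ((m : ℝ) + 1)) ⊆ O k := by
    intro k i
    obtain ⟨ε, hε, hball⟩ := Metric.isOpen_iff.1 (hO k) _ (hpO k i)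
    obtain ⟨N, hN⟩ := exists_nat_one_div_lt hε
    have hm := Nat.right_le_pair i (max N k)
    refine ⟨Nat.pair i (max N k), Nat.left_le_pair _ _, (le_max_right _ _).trans hm, by simp, ?_⟩
    refine (Metric.closedBall_subset_ball (lt_of_le_of_lt ?_ hN)).trans hball
    exact Nat.one_div_le_one_div ((le_max_left _ _).trans hm)
  choose next hle hkle hparent hsub using hnext
  let b : ℕ → ℕ := fun k => Nat.rec 0 (fun k i => next k i + 1) k
  have hb : ∀ k, b (k + 1) = next k (b k) + 1 := fun _ => rfl
  have hpiece : Antitone fun k => (g (b k)).piece := by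
    refine antitone_nat_of_succ_le fun k => ?_
    have := (hchild (next k (b k))).1
    rwa [hparent] at this
  have hball : ∀ k, closure (g (b (k + 1))).piece ⊆
      Metric.closedBall (g (b k)).point (1 / ((next k (b k) : ℝ) + 1)) := by
    intro k
    have := (hchild (next k (b k))).2.1
    rw [hparent] at this
    exact closure_minimal this Metric.isClosed_closedBall
  have hcode : ∀ k, ∃ a, (g (b (k + 1))).code = (g (b k)).code ++ [a] := by
    intro k
    have := (hchild (next k (b k))).2.2
    rwa [hparent] at this
  choose α hα using hcode
  have hcodes : ∀ k, (g (b k)).code = (List.range k).map α := by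
    intro k
    induction k with
    | zero => exact (hg 1).code_root one_pos
    | succ k ih => rw [hα, ih, List.range_succ, List.map_append, List.map_singleton]
  have hmono : StrictMono b := strictMono_nat_of_lt_succ fun k =>
    Nat.lt_succ_of_le (hle k (b k))
  have hmem' : ∀ k j, k ≤ j → (g (b j)).point ∈ closure (g (b k)).piece := fun k j hkj =>
    closure_mono (hpiece hkj) (hmem _)
  obtain ⟨x, hx⟩ := hconv α (fun k => (g (b k)).point)
    (by
      rw [Metric.cauchySeq_iff']
      intro ε hε
      obtain ⟨N, hN⟩ := exists_nat_one_div_lt hε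
      refine ⟨N, fun j hj => ?_⟩
      rcases hj.eq_or_lt with rfl | hj
      · simpa using hε
      · refine lt_of_le_of_lt ?_ hN
        exact (hball N (hmem' (N + 1) j hj)).trans (Nat.one_div_le_one_div (hkle N (b N))))
    (fun k j hkj => by
      rw [← hcodes]
      exact closure_mono ((hg (b k + 1)).piece_subset _ (Nat.lt_succ_self _)) (hmem' k j hkj))
  have hxmem : ∀ k, x ∈ closure (g (b k)).piece := fun k =>
    isClosed_closure.mem_of_tendsto hx ((eventually_ge_atTop k).mono (hmem' k))
  have hxU : x ∈ f ⁻¹' U := by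
    rw [hUO]
    exact mem_iInter.2 fun k => hsub k (b k) (hball k (hxmem (k + 1)))
  obtain ⟨j, hj⟩ := mem_iUnion.1 hxU
  have hout := (hg (b (j + 1) + 1)).closure_subset _ (Nat.lt_succ_self _) (hxmem (j + 1)) j
    (hmono.le_apply (x := j + 1))
  exact lt_asymm hout hj

end Scheme

theorem PiecewiseContinuous.delta02Measurable {X Y : Type*} [MetricSpace X] [TopologicalSpace Y]
    {f : X → Y} (hf : PiecewiseContinuous f) : Delta02Measurable f := by
  obtain ⟨C, hC, hcov, hCf⟩ := hf
  have hdecomp : ∀ s : Set X, s = ⋃ n, C n ∩ s := fun s => by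
    rw [← iUnion_inter, hcov, univ_inter]
  intro U hU
  constructor
  · have h : ∀ n, ∃ E : ℕ → Set X, (∀ m, IsClosed (E m)) ∧ C n ∩ f ⁻¹' U = ⋃ m, E m := by
      intro n
      obtain ⟨V, hV, hVU⟩ := continuousOn_iff'.1 (hCf n) U hU
      obtain ⟨E, hE, -, hEV, -⟩ := hV.exists_iUnion_isClosed
      refine ⟨fun m => E m ∩ C n, fun m => (hE m).inter (hC n), ?_⟩
      rw [inter_comm, hVU, ← hEV, iUnion_inter]
    choose E hE hEU using h
    refine ⟨fun k => E k.unpair.1 k.unpair.2, fun k => hE _ _, ?_⟩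
    rw [hdecomp (f ⁻¹' U), iUnion_unpair (fun n m => E n m)]
    exact iUnion_congr hEU
  · have h : ∀ n, IsClosed (C n ∩ f ⁻¹' Uᶜ) := fun n =>
      (hCf n).preimage_isClosed_of_isClosed (hC n) hU.isClosed_compl
    rw [← compl_compl (f ⁻¹' U), ← preimage_compl, hdecomp (f ⁻¹' Uᶜ), compl_iUnion]
    exact IsGδ.iInter_of_isOpen fun n => (h n).isOpen_compl

/-- Jayne–Rogers theorem: for an absolute Souslin-F set X (realized as a
Souslin-F subset of a complete metric space Z) and a metric space Y, a map
f : X → Y is Δ⁰₂-measurable iff it is piecewise continuous. -/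
theorem statement0 {Z Y : Type*} [MetricSpace Z] [CompleteSpace Z] [MetricSpace Y]
    (X : Set Z) (hX : SouslinF X) (f : X → Y) :
    Delta02Measurable f ↔ PiecewiseContinuous f := by
  refine ⟨fun hf => ?_, fun hf => hf.delta02Measurable⟩
  obtain ⟨F, hF, hXF⟩ := hX
  let S : List ℕ → Set X := fun s =>
    {x | ∃ α : ℕ → ℕ, (List.range s.length).map α = s ∧ ∀ n, (x : Z) ∈ F ((List.range n).map α)}
  have hSF : ∀ s, closure (S s) ⊆ Subtype.val ⁻¹' F s := by
    refine fun s => closure_minimal ?_ ((hF s).preimage continuous_subtype_val)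
    rintro x ⟨α, hα, hx⟩
    have := hx s.length
    rwa [hα] at this
  have hS0 : S [] = univ := by
    refine eq_univ_of_forall fun x => ?_
    obtain ⟨α, hα⟩ := mem_iUnion.1 (hXF.le x.2)
    exact ⟨α, rfl, mem_iInter.1 hα⟩
  have hS : ∀ s, S s ⊆ ⋃ a, S (s ++ [a]) := by
    rintro s x ⟨α, hα, hx⟩
    refine mem_iUnion.2 ⟨α s.length, α, ?_, hx⟩
    rw [List.length_append, List.length_singleton, List.range_succ, List.map_append, hα,
      List.map_singleton]
  obtain ⟨C, hC, hcov, hCf⟩ := hf.coveredByContinuousPieces hS0 hS fun α u hu hmem => by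
    obtain ⟨z, hz⟩ := cauchySeq_tendsto_of_complete
      (uniformContinuous_subtype_val.comp_cauchySeq hu)
    have hzX : z ∈ X := by
      rw [hXF]
      refine mem_iUnion.2 ⟨α, mem_iInter.2 fun k => (hF _).mem_of_tendsto hz ?_⟩
      exact (Filter.eventually_ge_atTop k).mono fun j hj => hSF _ (hmem k j hj)
    exact ⟨⟨z, hzX⟩, tendsto_subtype_rng.2 hz⟩
  exact ⟨C, hC, univ_subset_iff.1 hcov, hCf⟩
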